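/- arXiv:2512.08840 — 3 statements merged into one kernel-verified Lean document; each statement's English description precedes it below -/
import Mathlib

section
/- For every continuously differentiable, compactly supported function v : ℝ → ℝ, the quadratic form of the linearized operator L₋ is nonnegative: ∫_ℝ [ (v'(x))² + (1 - 4 φ(x)² + 3 φ(x)⁴) v(x)² ] dx ≥ 0. -/
open Real MeasureTheory

noncomputable def φ (x : ℝ) : ℝ := Real.sqrt ((1 + Real.tanh x) / 2)

lemma tanh_hasDerivAt_aux (x : ℝ) : HasDerivAt Real.tanh (1 - Real.tanh x ^ 2) x := by
  have hc : Real.cosh x ≠ 0 := (Real.cosh_pos x).ne'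
  have h := (Real.hasDerivAt_sinh x).div (Real.hasDerivAt_cosh x) hc
  have e : Real.tanh = Real.sinh / Real.cosh := by
    funext y
    simp [Real.tanh_eq_sinh_div_cosh]
  rw [e]
  refine h.congr_deriv ?_
  simp only [Pi.div_apply]
  field_simp

lemma phi_sq_aux (x : ℝ) : φ x ^ 2 = (1 + Real.tanh x) / 2 := by
  have h := Real.neg_one_lt_tanh x
  exact Real.sq_sqrt (by linarith)

theorem Lminus_quadratic_form_nonneg (v : ℝ → ℝ)
    (hv : ContDiff ℝ 1 v) (hsupp : HasCompactSupport v) :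
    0 ≤ ∫ x : ℝ,
      ((deriv v x) ^ 2 + (1 - 4 * (φ x) ^ 2 + 3 * (φ x) ^ 4) * (v x) ^ 2) := by
  have hvc : Continuous v := hv.continuous
  have hdc : Continuous (deriv v) := hv.continuous_deriv le_rfl
  have htc : Continuous Real.tanh :=
    continuous_iff_continuousAt.2 fun x => (tanh_hasDerivAt_aux x).continuousAt
  have hds : HasCompactSupport (deriv v) := hsupp.deriv
  let w : ℝ → ℝ := fun x => (1 - Real.tanh x) / 2
  let w' : ℝ → ℝ := fun x => -(1 - Real.tanh x ^ 2) / 2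
  have hw (x : ℝ) : HasDerivAt w (w' x) x :=
    ((tanh_hasDerivAt_aux x).const_sub 1).div_const 2
  have hwc : Continuous w := by fun_prop
  have hwc' : Continuous w' := by fun_prop
  let F : ℝ → ℝ := fun x => v x * (w x * v x)
  let F' : ℝ → ℝ := fun x => v x * (w' x * v x + 2 * w x * deriv v x)
  have hF (x : ℝ) : HasDerivAt F (F' x) x := by
    have hvd : HasDerivAt v (deriv v x) x :=
      (hv.differentiable one_ne_zero x).hasDerivAt
    refine (hvd.mul ((hw x).mul hvd)).congr_deriv ?_
    simp only [F', Pi.mul_apply]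
    ring
  have hFi : Integrable F := by
    refine Continuous.integrable_of_hasCompactSupport (by fun_prop) ?_
    exact hsupp.mul_right
  have hFi' : Integrable F' := by
    refine Continuous.integrable_of_hasCompactSupport (by fun_prop) ?_
    exact hsupp.mul_right
  let G : ℝ → ℝ := fun x => (deriv v x - w x * v x) ^ 2
  have hGi : Integrable G := by
    refine Continuous.integrable_of_hasCompactSupport (by fun_prop) ?_
    have h1 : HasCompactSupport (fun x => deriv v x - w x * v x) :=
      hds.sub hsupp.mul_left
    exact h1.comp_left (g := fun y : ℝ => y ^ 2) (by norm_num)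
  have h0 : ∫ x, F' x = 0 := integral_eq_zero_of_hasDerivAt_of_integrable hF hFi' hFi
  have key : ∀ x, (deriv v x) ^ 2 + (1 - 4 * (φ x) ^ 2 + 3 * (φ x) ^ 4) * (v x) ^ 2
      = G x + F' x := by
    intro x
    have h4 : φ x ^ 4 = (φ x ^ 2) ^ 2 := by ring
    rw [h4, phi_sq_aux]
    simp only [G, F', w, w']
    ring
  simp_rw [key]
  rw [integral_add hGi hFi', h0, add_zero]
  exact integral_nonneg fun x => sq_nonneg _
end

section
/- Fix R ∈ ℝ. There exists a constant C₋ > 0 such that for every locally absolutely continuous v : ℝ → ℝ with v' ∈ L²(ℝ), ∫_ℝ W_R(x) v(x)² dx < ∞, and satisfying the orthogonality constraint ∫_ℝ W_R(x) v(x) φ(x) dx = 0, one has ∫_ℝ [ (v'(x))² + (1 - 4 φ(x)² + 3 φ(x)⁴) v(x)² ] dx ≥ C₋ ( ∫_ℝ (v'(x))² dx + ∫_ℝ W_R(x) v(x)² dx ). -/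
open Real MeasureTheory Set

/-- The weight of the Hilbert space `𝓗_R`. -/
noncomputable def W (R x : ℝ) : ℝ :=
  if x ≤ R then 1 else (1 - (φ x) ^ 2) / (1 - (φ R) ^ 2)

namespace Coer

noncomputable def q (x : ℝ) : ℝ := 1 - (φ x) ^ 2

lemma phi_sq (x : ℝ) : (φ x) ^ 2 = (1 + Real.tanh x) / 2 := by
  unfold φ
  rw [Real.sq_sqrt]
  have := Real.neg_one_lt_tanh x
  linarith

lemma phi_pos (x : ℝ) : 0 < φ x := by
  unfold φ
  apply Real.sqrt_pos.mpr
  have := Real.neg_one_lt_tanh x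
  linarith

lemma q_pos (x : ℝ) : 0 < q x := by
  unfold q
  rw [phi_sq]
  have := Real.tanh_lt_one x
  linarith

lemma q_le (x : ℝ) : q x ≤ 1 := by
  unfold q
  have := sq_nonneg (φ x)
  linarith

lemma hasDeriv_tanh (x : ℝ) : HasDerivAt Real.tanh (1 - Real.tanh x ^ 2) x := by
  have h := (Real.hasDerivAt_sinh x).div (Real.hasDerivAt_cosh x) (Real.cosh_pos x).ne'
  have e : Real.tanh = Real.sinh / Real.cosh := by
    funext y; simp [Real.tanh_eq_sinh_div_cosh]
  rw [Real.tanh_eq_sinh_div_cosh, e]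
  refine h.congr_deriv ?_
  have := (Real.cosh_pos x).ne'
  rw [div_pow]
  field_simp

lemma hasDeriv_phi (x : ℝ) : HasDerivAt φ (q x * φ x) x := by
  have h1 : HasDerivAt (fun y => (1 + Real.tanh y) / 2) ((1 - Real.tanh x ^ 2) / 2) x :=
    ((hasDeriv_tanh x).const_add 1).div_const 2
  have hne : (1 + Real.tanh x) / 2 ≠ 0 := by
    rw [← phi_sq]; exact (pow_pos (phi_pos x) 2).ne'
  have h2 := h1.sqrt hne
  have e : (fun y => Real.sqrt ((1 + Real.tanh y) / 2)) = φ := rfl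
  rw [e] at h2
  convert h2 using 1
  change _ = _ / (2 * φ x)
  have hp := phi_pos x
  have hs := phi_sq x
  have ht : Real.tanh x = 2 * φ x ^ 2 - 1 := by linarith
  rw [ht, q]
  field_simp
  ring

lemma hasDeriv_q (x : ℝ) : HasDerivAt q (-(2 * φ x ^ 2 * q x)) x := by
  have h : HasDerivAt q _ x := ((hasDeriv_phi x).fun_pow 2).const_sub 1
  refine h.congr_deriv ?_
  simp only [Nat.cast_ofNat]
  ring

lemma cont_phi : Continuous φ :=
  continuous_iff_continuousAt.mpr fun x => (hasDeriv_phi x).continuousAt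

lemma cont_q : Continuous q :=
  continuous_iff_continuousAt.mpr fun x => (hasDeriv_q x).continuousAt

lemma q_anti : Antitone q := by
  apply antitone_of_deriv_nonpos
  · exact fun x => (hasDeriv_q x).differentiableAt
  · intro x
    rw [(hasDeriv_q x).deriv]
    have := q_pos x
    have := mul_nonneg (mul_nonneg zero_le_two (sq_nonneg (φ x))) this.le
    linarith

lemma exists_x0 : ∃ x0, q x0 = 1 / 4 := by
  refine ⟨Real.artanh (1/2), ?_⟩
  rw [q, phi_sq, Real.tanh_artanh (by constructor <;> norm_num)]
  norm_num

lemma integrable_q_phi : Integrable (fun x => q x * φ x ^ 2) := by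
  refine integrable_inv_one_add_sq.mono'
    (cont_q.mul (cont_phi.pow 2)).aestronglyMeasurable (ae_of_all _ fun x => ?_)
  rw [Real.norm_of_nonneg (mul_nonneg (q_pos x).le (sq_nonneg _)), q, phi_sq,
    Real.tanh_eq_sinh_div_cosh]
  have hc := Real.cosh_pos x
  have hcs := Real.cosh_sq x
  have hs : x ^ 2 ≤ Real.sinh x ^ 2 := by
    rw [← sq_abs x, ← sq_abs (Real.sinh x), Real.abs_sinh]
    exact pow_le_pow_left₀ (abs_nonneg x) (Real.self_le_sinh_iff.mpr (abs_nonneg x)) 2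
  have e : (1 - (1 + Real.sinh x / Real.cosh x) / 2) * ((1 + Real.sinh x / Real.cosh x) / 2)
      = 1 / (4 * Real.cosh x ^ 2) := by
    field_simp
    nlinarith
  rw [e, ← one_div]
  apply one_div_le_one_div_of_le
  · positivity
  · nlinarith

lemma W_ge (R x : ℝ) : q x ≤ W R x := by
  unfold W
  split_ifs
  · exact q_le x
  · change q x ≤ q x / q R
    rw [le_div_iff₀ (q_pos R)]
    have := q_pos x
    have := q_le R
    nlinarith

lemma W_le (R x : ℝ) : W R x ≤ q x / q R := by
  unfold W
  split_ifs with h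
  · rw [le_div_iff₀ (q_pos R), one_mul]
    exact q_anti h
  · exact le_rfl

lemma W_pos (R x : ℝ) : 0 < W R x := (q_pos x).trans_le (W_ge R x)

lemma W_meas (R : ℝ) : Measurable (W R) := by
  unfold W
  exact Measurable.ite measurableSet_Iic measurable_const
    (((continuous_const.sub (cont_phi.pow 2)).div_const _).measurable)

/-- Hardy inequality via a multiplier. -/
lemma hardy (x0 : ℝ) (hx0 : q x0 = 1 / 4) (f f' : ℝ → ℝ) (hf : ∀ x, HasDerivAt f (f' x) x)
    (hm : Measurable f') (h0 : f x0 = 0)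
    (h1 : Integrable (fun x => q x * f x ^ 2))
    (h2 : Integrable (fun x => (f' x - q x * f x) ^ 2)) :
    ∫ x, q x * f x ^ 2 ≤ 4 * ∫ x, (f' x - q x * f x) ^ 2 := by
  classical
  set P : ℝ → ℝ := fun x => if x ≤ x0 then 1 / 4 else - q x with hP
  set P' : ℝ → ℝ := fun x => if x ≤ x0 then 0 else 2 * φ x ^ 2 * q x with hP'
  set g' : ℝ → ℝ := fun x => P' x * f x ^ 2 + P x * (2 * f x * f' x) with hg'
  have fc : Continuous f := continuous_iff_continuousAt.mpr fun x => (hf x).continuousAt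
  have hf2 : ∀ x, HasDerivAt (fun y => f y ^ 2) (2 * f x * f' x) x := by
    intro x
    have := (hf x).fun_pow 2
    simpa using this
  have mP : Measurable P :=
    Measurable.ite measurableSet_Iic measurable_const cont_q.neg.measurable
  have mP' : Measurable P' :=
    Measurable.ite measurableSet_Iic measurable_const
      ((continuous_const.mul (cont_phi.pow 2)).mul cont_q).measurable
  have bP : ∀ x, |P x| ≤ q x := by
    intro x
    simp only [hP]
    split_ifs with h
    · have := q_anti h
      rw [abs_of_pos (by norm_num)]
      linarith
    · rw [abs_neg, abs_of_pos (q_pos x)]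
  have bP' : ∀ x, |P' x| ≤ 2 * q x := by
    intro x
    have := q_pos x
    simp only [hP']
    split_ifs with h
    · simp; linarith
    · rw [abs_of_nonneg (by positivity)]
      have : φ x ^ 2 ≤ 1 := by have := q_pos x; unfold q at this; linarith
      nlinarith
  have hL : ∀ x, HasDerivAt (fun y => (1 / 4 : ℝ) * f y ^ 2) (1 / 4 * (2 * f x * f' x)) x :=
    fun x => (hf2 x).const_mul _
  have hR : ∀ x, HasDerivAt (fun y => - q y * f y ^ 2)
      (2 * φ x ^ 2 * q x * f x ^ 2 + - q x * (2 * f x * f' x)) x := by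
    intro x
    have := ((hasDeriv_q x).neg).mul (hf2 x)
    refine this.congr_deriv ?_
    simp
  have hd : ∀ x, HasDerivAt (fun y => P y * f y ^ 2) (g' x) x := by
    intro x
    rcases lt_trichotomy x x0 with h | h | h
    · have e : g' x = 1 / 4 * (2 * f x * f' x) := by simp [hg', hP, hP', h.le]
      rw [e]
      refine (hL x).congr_of_eventuallyEq ?_
      filter_upwards [Iio_mem_nhds h] with y hy
      have : y ≤ x0 := le_of_lt hy
      simp [hP, this]
    · subst h
      have e : g' x = 0 := by simp [hg', h0]
      rw [e]
      have l : HasDerivWithinAt (fun y => P y * f y ^ 2) 0 (Iic x) x := by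
        have := (hL x).hasDerivWithinAt (s := Iic x)
        rw [h0] at this
        simp only [mul_zero, zero_mul] at this
        refine this.congr (fun y hy => ?_) ?_
        · have : y ≤ x := hy
          simp [hP, this]
        · simp [h0]
      have r : HasDerivWithinAt (fun y => P y * f y ^ 2) 0 (Ioi x) x := by
        have := (hR x).hasDerivWithinAt (s := Ioi x)
        rw [h0] at this
        simp only [mul_zero, zero_mul, ne_eq, OfNat.ofNat_ne_zero, not_false_eq_true, zero_pow,
          add_zero] at this
        refine this.congr (fun y hy => ?_) ?_
        · have : ¬ y ≤ x := not_le.mpr hy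
          simp [hP, this]
        · simp [h0]
      have := l.union r
      rwa [Iic_union_Ioi, hasDerivWithinAt_univ] at this
    · have h' := not_le.mpr h
      have e : g' x = 2 * φ x ^ 2 * q x * f x ^ 2 + - q x * (2 * f x * f' x) := by
        simp [hg', hP, hP', h']
      rw [e]
      refine (hR x).congr_of_eventuallyEq ?_
      filter_upwards [Ioi_mem_nhds h] with y hy
      have : ¬ y ≤ x0 := not_le.mpr hy
      simp [hP, this]
  have ig : Integrable (fun y => P y * f y ^ 2) := by
    refine h1.mono' (mP.mul (fc.pow 2).measurable).aestronglyMeasurable (ae_of_all _ fun x => ?_)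
    rw [norm_mul, Real.norm_eq_abs, Real.norm_of_nonneg (sq_nonneg _)]
    exact mul_le_mul_of_nonneg_right (bP x) (sq_nonneg _)
  have ig' : Integrable g' := by
    refine ((h1.const_mul 5).add h2).mono'
      ((mP'.mul (fc.pow 2).measurable).add
        (mP.mul ((fc.measurable.const_mul 2).mul hm))).aestronglyMeasurable
      (ae_of_all _ fun x => ?_)
    simp only [Pi.add_apply, hg']
    have hq := q_pos x
    have hq1 := q_le x
    set h := f' x - q x * f x with hh
    have hf' : f' x = h + q x * f x := by rw [hh]; ring
    rw [hf', Real.norm_eq_abs]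
    refine (abs_add_le _ _).trans ?_
    rw [abs_mul, abs_mul, abs_of_nonneg (sq_nonneg (f x))]
    have a1 : |P' x| * f x ^ 2 ≤ 2 * q x * f x ^ 2 :=
      mul_le_mul_of_nonneg_right (bP' x) (sq_nonneg _)
    have a2 : |P x| * |2 * f x * (h + q x * f x)| ≤ q x * |2 * f x * (h + q x * f x)| :=
      mul_le_mul_of_nonneg_right (bP x) (abs_nonneg _)
    have a3 : |2 * f x * (h + q x * f x)| ≤ f x ^ 2 + h ^ 2 + 2 * f x ^ 2 := by
      have := mul_le_mul_of_nonneg_right hq1 (sq_nonneg (f x))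
      have := mul_nonneg hq.le (sq_nonneg (f x))
      rw [abs_le]
      constructor <;> nlinarith [sq_nonneg (f x + h), sq_nonneg (f x - h)]
    have a4 := mul_le_mul_of_nonneg_left a3 hq.le
    have a5 := mul_le_mul_of_nonneg_right hq1 (sq_nonneg h)
    nlinarith
  have key : ∫ x, g' x = 0 := integral_eq_zero_of_hasDerivAt_of_integrable hd ig' ig
  have pw : ∀ x, (1 / 4) * (q x * f x ^ 2) - g' x ≤ (f' x - q x * f x) ^ 2 := by
    intro x
    have hq := q_pos x
    simp only [hg', hP, hP']
    split_ifs with h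
    · have := q_anti h
      rw [hx0] at this
      have := mul_le_mul_of_nonneg_right this (sq_nonneg (f x))
      nlinarith [sq_nonneg (f' x - q x * f x + 1 / 4 * f x)]
    · have := q_anti (not_le.mp h).le
      rw [hx0] at this
      have e : φ x ^ 2 = 1 - q x := by unfold q; ring
      rw [e]
      have := mul_le_mul_of_nonneg_right this (mul_nonneg hq.le (sq_nonneg (f x)))
      have := mul_nonneg hq.le (sq_nonneg (f x))
      nlinarith [sq_nonneg (f' x - q x * f x - q x * f x)]
  have := integral_mono ((h1.const_mul (1 / 4)).sub ig') h2 pw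
  simp only [Pi.sub_apply] at this
  rw [integral_sub (h1.const_mul (1 / 4)) ig', key, integral_const_mul] at this
  linarith

end Coer

open Coer

theorem coercivity_Lminus (R : ℝ) :
    ∃ C > (0 : ℝ), ∀ v : ℝ → ℝ, Differentiable ℝ v →
      Integrable (fun x => (deriv v x) ^ 2) →
      Integrable (fun x => W R x * (v x) ^ 2) →
      (∫ x : ℝ, W R x * v x * φ x) = 0 →
      C * ((∫ x : ℝ, (deriv v x) ^ 2) + ∫ x : ℝ, W R x * (v x) ^ 2) ≤
        ∫ x : ℝ, ((deriv v x) ^ 2 + (1 - 4 * (φ x) ^ 2 + 3 * (φ x) ^ 4) * (v x) ^ 2) := by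
  have hqR := q_pos R
  refine ⟨1 / (1 + 12 / q R), by positivity, ?_⟩
  intro v hv hv' hW horth
  obtain ⟨x0, hx0⟩ := exists_x0
  have vc := hv.continuous
  have vm : Measurable (deriv v) := measurable_deriv v
  have hqv : Integrable (fun x => q x * v x ^ 2) := by
    refine hW.mono' (cont_q.mul (vc.pow 2)).aestronglyMeasurable (ae_of_all _ fun x => ?_)
    rw [Real.norm_of_nonneg (mul_nonneg (q_pos x).le (sq_nonneg _))]
    exact mul_le_mul_of_nonneg_right (W_ge R x) (sq_nonneg _)
  have hVeq : ∀ x, 1 - 4 * (φ x) ^ 2 + 3 * (φ x) ^ 4 = q x * (1 - 3 * φ x ^ 2) := by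
    intro x; unfold q; ring
  have hs : ∀ x, φ x ^ 2 = 1 - q x := by intro x; unfold q; ring
  have hV : Integrable (fun x => (1 - 4 * (φ x) ^ 2 + 3 * (φ x) ^ 4) * (v x) ^ 2) := by
    refine (hqv.const_mul 2).mono' (Continuous.aestronglyMeasurable (by
      have := cont_phi
      fun_prop)) (ae_of_all _ fun x => ?_)
    have hq := q_pos x
    have hq1 := q_le x
    have := mul_nonneg hq.le (sq_nonneg (v x))
    rw [hVeq, hs, Real.norm_eq_abs, abs_le]
    constructor <;> nlinarith
  have hh2 : Integrable (fun x => (deriv v x - q x * v x) ^ 2) := by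
    refine ((hv'.const_mul 2).add (hqv.const_mul 2)).mono'
      ((vm.sub (cont_q.mul vc).measurable).pow_const 2).aestronglyMeasurable
      (ae_of_all _ fun x => ?_)
    have hq := q_pos x
    have hq1 := q_le x
    have := mul_nonneg hq.le (sq_nonneg (v x))
    simp only [Pi.add_apply]
    rw [Real.norm_of_nonneg (sq_nonneg _)]
    nlinarith [sq_nonneg (deriv v x + q x * v x)]
  set Q := ∫ x : ℝ, ((deriv v x) ^ 2 + (1 - 4 * (φ x) ^ 2 + 3 * (φ x) ^ 4) * (v x) ^ 2) with hQ
  have hQeq : Q = ∫ x, (deriv v x - q x * v x) ^ 2 := by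
    have hd : ∀ x, HasDerivAt (fun y => q y * v y ^ 2)
        ((deriv v x) ^ 2 + (1 - 4 * (φ x) ^ 2 + 3 * (φ x) ^ 4) * (v x) ^ 2
          - (deriv v x - q x * v x) ^ 2) x := by
      intro x
      have := (hasDeriv_q x).mul ((hv x).hasDerivAt.fun_pow 2)
      refine this.congr_deriv ?_
      rw [hVeq, hs]
      simp only [Nat.cast_ofNat]
      ring
    have := integral_eq_zero_of_hasDerivAt_of_integrable hd ((hv'.add hV).sub hh2) hqv
    rw [integral_sub (f := fun x => (deriv v x) ^ 2 +
      (1 - 4 * (φ x) ^ 2 + 3 * (φ x) ^ 4) * (v x) ^ 2) (hv'.add hV) hh2] at this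
    linarith
  have hQsum : Q = (∫ x, (deriv v x) ^ 2) +
      ∫ x, (1 - 4 * (φ x) ^ 2 + 3 * (φ x) ^ 4) * (v x) ^ 2 := integral_add hv' hV
  set c := v x0 / φ x0 with hc
  have hp0 := (phi_pos x0).ne'
  have hWphi : Integrable (fun x => W R x * φ x ^ 2) := by
    refine (integrable_q_phi.const_mul (1 / q R)).mono'
      ((W_meas R).mul (cont_phi.pow 2).measurable).aestronglyMeasurable (ae_of_all _ fun x => ?_)
    rw [Real.norm_of_nonneg (mul_nonneg (W_pos R x).le (sq_nonneg _))]
    have := mul_le_mul_of_nonneg_right (W_le R x) (sq_nonneg (φ x))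
    refine this.trans (le_of_eq ?_)
    ring
  have hWvp : Integrable (fun x => W R x * v x * φ x) := by
    refine (hW.add hWphi).mono'
      (((W_meas R).mul vc.measurable).mul cont_phi.measurable).aestronglyMeasurable
      (ae_of_all _ fun x => ?_)
    have hw := W_pos R x
    simp only [Pi.add_apply]
    rw [mul_assoc, norm_mul, Real.norm_of_nonneg hw.le, ← mul_add]
    apply mul_le_mul_of_nonneg_left _ hw.le
    rw [Real.norm_eq_abs, abs_le]
    constructor <;> nlinarith [sq_nonneg (v x + φ x), sq_nonneg (v x - φ x)]
  have hWf_eq : (fun x => W R x * (v x - c * φ x) ^ 2) = fun x =>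
      (W R x * v x ^ 2 - (2 * c) * (W R x * v x * φ x)) + c ^ 2 * (W R x * φ x ^ 2) := by
    funext x; ring
  have hWf : Integrable (fun x => W R x * (v x - c * φ x) ^ 2) := by
    rw [hWf_eq]
    exact (hW.sub (hWvp.const_mul _)).add (hWphi.const_mul _)
  have hWle : ∫ x, W R x * v x ^ 2 ≤ ∫ x, W R x * (v x - c * φ x) ^ 2 := by
    rw [hWf_eq, integral_add (f := fun x => W R x * v x ^ 2 - (2 * c) * (W R x * v x * φ x))
      (hW.sub (hWvp.const_mul _)) (hWphi.const_mul _),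
      integral_sub hW (hWvp.const_mul _), integral_const_mul, integral_const_mul, horth]
    have : 0 ≤ ∫ x, W R x * φ x ^ 2 :=
      integral_nonneg fun x => mul_nonneg (W_pos R x).le (sq_nonneg _)
    have := mul_nonneg (sq_nonneg c) this
    linarith
  have hqf : Integrable (fun x => q x * (v x - c * φ x) ^ 2) := by
    refine hWf.mono' (cont_q.mul ((vc.sub (cont_phi.const_mul c)).pow 2)).aestronglyMeasurable
      (ae_of_all _ fun x => ?_)
    rw [Real.norm_of_nonneg (mul_nonneg (q_pos x).le (sq_nonneg _))]
    exact mul_le_mul_of_nonneg_right (W_ge R x) (sq_nonneg _)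
  have e2 : ∀ x, (deriv v x - c * (q x * φ x)) - q x * (v x - c * φ x)
      = deriv v x - q x * v x := by intro x; ring
  have hH := hardy x0 hx0 (fun x => v x - c * φ x) (fun x => deriv v x - c * (q x * φ x))
    (fun x => (hv x).hasDerivAt.sub ((hasDeriv_phi x).const_mul c))
    (vm.sub ((cont_q.mul cont_phi).const_mul c).measurable)
    (by simp only [hc]; field_simp; ring) hqf (by simp only [e2]; exact hh2)
  simp only [e2] at hH
  rw [← hQeq] at hH
  have hWq : ∫ x, W R x * (v x - c * φ x) ^ 2 ≤ (1 / q R) * ∫ x, q x * (v x - c * φ x) ^ 2 := by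
    rw [← integral_const_mul]
    refine integral_mono hWf (hqf.const_mul _) fun x => ?_
    have := mul_le_mul_of_nonneg_right (W_le R x) (sq_nonneg (v x - c * φ x))
    refine this.trans (le_of_eq ?_)
    ring
  have hWfin : ∫ x, W R x * v x ^ 2 ≤ (4 / q R) * Q := by
    have := mul_le_mul_of_nonneg_left hH (by positivity : (0:ℝ) ≤ 1 / q R)
    calc _ ≤ _ := hWle.trans (hWq.trans this)
      _ = _ := by ring
  have hVlow : -(2 * ∫ x, W R x * v x ^ 2) ≤
      ∫ x, (1 - 4 * (φ x) ^ 2 + 3 * (φ x) ^ 4) * (v x) ^ 2 := by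
    rw [← integral_const_mul, ← integral_neg]
    refine integral_mono (hW.const_mul 2).neg hV fun x => ?_
    have hq := q_pos x
    have h1 := mul_le_mul_of_nonneg_right (W_ge R x) (sq_nonneg (v x))
    have h2 := mul_nonneg hq.le (mul_nonneg hq.le (sq_nonneg (v x)))
    simp only
    rw [hVeq, hs]
    nlinarith
  rw [one_div, inv_mul_le_iff₀ (by positivity)]
  have : (1 + 12 / q R) * Q = Q + 3 * ((4 / q R) * Q) := by ring
  rw [this]
  linarith
end

section
/- There exists R₀ > 0 such that for every R > R₀ there is a constant C_R > 0 with the following property: for every locally absolutely continuous u : ℝ → ℝ with u' ∈ L²(ℝ), ∫_ℝ W_R(x) u(x)² dx < ∞, and satisfying the orthogonality constraint ∫_ℝ u(x) φ'(x) dx = 0, one has ∫_{-∞}^R [ (u'(x))² + (1 - 12 φ(x)² + 15 φ(x)⁴) u(x)² ] dx + ∫_R^{∞} [ (u'(x))² + (1 - 4 φ(x)² + 3 φ(x)⁴) u(x)² ] dx ≥ C_R ( ∫_ℝ (u'(x))² dx + ∫_ℝ W_R(x) u(x)² dx ). -/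
open Real MeasureTheory Set

noncomputable def T (x : ℝ) : ℝ := (1 + Real.exp (-(2 * x)))⁻¹

lemma T_pos (x : ℝ) : 0 < T x := by unfold T; positivity

lemma T_lt (x : ℝ) : T x < 1 := by
  unfold T
  apply inv_lt_one_of_one_lt₀
  linarith [Real.exp_pos (-(2 * x))]

lemma T_eq (x : ℝ) : (1 + Real.tanh x) / 2 = T x := by
  unfold T
  rw [Real.tanh_eq_sinh_div_cosh, Real.sinh_eq, Real.cosh_eq]
  have h : Real.exp (-(2 * x)) = Real.exp (-x) * Real.exp (-x) := by
    rw [← Real.exp_add]; ring_nf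
  have h2 : Real.exp x * Real.exp (-x) = 1 := by rw [← Real.exp_add]; simp
  rw [h]
  have h1 := Real.exp_pos x
  have h3 := Real.exp_pos (-x)
  field_simp
  linear_combination (2 * Real.exp (-x)) * h2

lemma T_deriv (x : ℝ) : HasDerivAt T (2 * T x * (1 - T x)) x := by
  have h0 : HasDerivAt (fun y : ℝ => -(2 * y)) (-2) x := by
    simpa using ((hasDerivAt_id x).const_mul (2:ℝ)).fun_neg
  have h1 : HasDerivAt (fun y : ℝ => 1 + Real.exp (-(2 * y)))
      (Real.exp (-(2 * x)) * (-2)) x := (h0.exp).const_add 1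
  have hp : 1 + Real.exp (-(2 * x)) ≠ 0 := by positivity
  have h2 := h1.fun_inv hp
  have : 2 * T x * (1 - T x) =
      -(Real.exp (-(2 * x)) * (-2)) / (1 + Real.exp (-(2 * x))) ^ 2 := by
    unfold T
    field_simp
    ring
  rw [this]
  exact h2

lemma T_cont : Continuous T :=
  continuous_iff_continuousAt.2 fun x => (T_deriv x).continuousAt

lemma T_mono : Monotone T := by
  intro x y h
  unfold T
  have : Real.exp (-(2 * y)) ≤ Real.exp (-(2 * x)) := Real.exp_le_exp.2 (by linarith)
  gcongr

lemma T_log2 : T (Real.log 2) = 4 / 5 := by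
  unfold T
  have : Real.exp (-(2 * Real.log 2)) = 1 / 4 := by
    rw [Real.exp_neg, two_mul, Real.exp_add, Real.exp_log (by norm_num)]; norm_num
  rw [this]; norm_num

lemma T_tendsto : Filter.Tendsto T Filter.atTop (nhds 1) := by
  have h : Filter.Tendsto (fun x : ℝ => -(2 * x)) Filter.atTop Filter.atBot :=
    Filter.tendsto_neg_atTop_atBot.comp
      (Filter.tendsto_id.const_mul_atTop (by norm_num : (0:ℝ) < 2))
  have h2 := (Real.tendsto_exp_atBot.comp h).const_add 1
  have h3 := h2.inv₀ (by norm_num)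
  have h4 : T = fun x => (1 + Real.exp (-(2 * x)))⁻¹ := rfl
  rw [h4]
  simpa using h3

lemma phi_eq (x : ℝ) : φ x = Real.sqrt (T x) := by unfold φ; rw [T_eq]

lemma phi_sq (x : ℝ) : (φ x) ^ 2 = T x := by
  rw [phi_eq, Real.sq_sqrt (T_pos x).le]

lemma phi_pos (x : ℝ) : 0 < φ x := by rw [phi_eq]; exact Real.sqrt_pos.2 (T_pos x)

lemma phi_4 (x : ℝ) : (φ x) ^ 4 = T x ^ 2 := by rw [← phi_sq]; ring

lemma phi_deriv (x : ℝ) : HasDerivAt φ (φ x * (1 - T x)) x := by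
  have h : φ = fun y => Real.sqrt (T y) := funext phi_eq
  have h1 := (T_deriv x).sqrt (T_pos x).ne'
  rw [← phi_eq x] at h1
  rw [← h] at h1
  refine (HasDerivAt.congr_deriv h1 ?_)
  have := phi_pos x
  have h2 := phi_sq x
  field_simp
  rw [h2]
  ring

/-- the zero mode -/
noncomputable def psi (x : ℝ) : ℝ := φ x * (1 - T x)

lemma psi_deriv (x : ℝ) : HasDerivAt psi ((1 - 3 * T x) * psi x) x := by
  have h := (phi_deriv x).mul ((T_deriv x).const_sub 1)
  have e : psi = fun y => φ y * (1 - T y) := rfl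
  rw [e]
  refine HasDerivAt.congr_deriv h ?_
  ring

lemma psi_sq (x : ℝ) : psi x ^ 2 = T x * (1 - T x) ^ 2 := by
  unfold psi; rw [mul_pow, phi_sq]

lemma psi_pos (x : ℝ) : 0 < psi x := mul_pos (phi_pos x) (by linarith [T_lt x])

lemma psi_cont : Continuous psi :=
  continuous_iff_continuousAt.2 fun x => (psi_deriv x).continuousAt

lemma ftc_Iic {F F' : ℝ → ℝ} {R : ℝ} (h : ∀ x, HasDerivAt F (F' x) x)
    (hF : IntegrableOn F (Iic R)) (hF' : IntegrableOn F' (Iic R)) :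
    ∫ x in Iic R, F' x = F R := by
  have h0 := tendsto_zero_of_hasDerivAt_of_integrableOn_Iic (fun x _ => h x) hF' hF
  have := integral_Iic_of_hasDerivAt_of_tendsto' (fun x _ => h x) hF' h0
  simpa using this

lemma ftc_Ioi {F F' : ℝ → ℝ} {R : ℝ} (h : ∀ x, HasDerivAt F (F' x) x)
    (hF : IntegrableOn F (Ioi R)) (hF' : IntegrableOn F' (Ioi R)) :
    ∫ x in Ioi R, F' x = - F R := by
  have h0 := tendsto_zero_of_hasDerivAt_of_integrableOn_Ioi (fun x _ => h x) hF' hF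
  have := integral_Ioi_of_hasDerivAt_of_tendsto' (fun x _ => h x) hF' h0
  simpa using this

lemma bddmul {q f : ℝ → ℝ} {S : Set ℝ} (hS : MeasurableSet S) (M : ℝ) (hq : Continuous q)
    (hM : ∀ x ∈ S, |q x| ≤ M) (hf : IntegrableOn f S) :
    IntegrableOn (fun x => q x * f x) S := by
  refine Integrable.bdd_mul (c := M) hf hq.aestronglyMeasurable ?_
  exact (ae_restrict_iff' hS).2 (Filter.Eventually.of_forall hM)

lemma prodint {f g : ℝ → ℝ} {S : Set ℝ} (hf : Measurable f) (hg : Measurable g)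
    (h1 : IntegrableOn (fun x => f x ^ 2) S) (h2 : IntegrableOn (fun x => g x ^ 2) S) :
    IntegrableOn (fun x => f x * g x) S := by
  refine Integrable.mono' (h1.add h2) (by fun_prop) (Filter.Eventually.of_forall fun x => ?_)
  simp only [Pi.add_apply, Real.norm_eq_abs, abs_le]
  constructor <;> nlinarith [sq_nonneg (f x + g x), sq_nonneg (f x - g x)]

/-- Riccati lower bound on a set where the fundamental theorem of calculus holds -/
lemma riccati {S : Set ℝ} (hS : MeasurableSet S) {u p p' V : ℝ → ℝ} {M c B : ℝ}
    (hu : Differentiable ℝ u) (hp : Continuous p) (hp' : Continuous p') (hV : Continuous V)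
    (bp : ∀ x ∈ S, |p x| ≤ M) (bp' : ∀ x ∈ S, |p' x| ≤ M) (bV : ∀ x ∈ S, |V x| ≤ M)
    (hu1 : IntegrableOn (fun x => deriv u x ^ 2) S) (hu2 : IntegrableOn (fun x => u x ^ 2) S)
    (hc : ∀ x ∈ S, c ≤ V x - p' x - p x ^ 2)
    (hB : IntegrableOn (fun x => p x * u x ^ 2) S →
      IntegrableOn (fun x => p' x * u x ^ 2 + p x * (2 * u x * deriv u x)) S →
      ∫ x in S, (p' x * u x ^ 2 + p x * (2 * u x * deriv u x)) = B) :
    B + c * ∫ x in S, u x ^ 2 ≤ ∫ x in S, (deriv u x ^ 2 + V x * u x ^ 2) := by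
  have i1 := bddmul hS M hp bp hu2
  have i2 := bddmul hS M hp' bp' hu2
  have i3 : IntegrableOn (fun x => 2 * u x * deriv u x) S := by
    have := (prodint hu.continuous.measurable (measurable_deriv u) hu2 hu1).const_mul 2
    simpa [mul_assoc, IntegrableOn] using this
  have i4 := bddmul hS M hp bp i3
  have i5 := bddmul hS M hV bV hu2
  have i6 : IntegrableOn (fun x => p' x * u x ^ 2 + p x * (2 * u x * deriv u x)) S := i2.add i4
  rw [← hB i1 i6, ← integral_const_mul, ← integral_add i6 (hu2.const_mul c)]
  refine setIntegral_mono_on (i6.add (hu2.const_mul c)) (hu1.add i5) hS fun x hx => ?_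
  have := hc x hx
  nlinarith [sq_nonneg (deriv u x - p x * u x), mul_le_mul_of_nonneg_right this (sq_nonneg (u x))]

lemma sq_deriv {u p p' : ℝ → ℝ} (hu : Differentiable ℝ u) (hp : ∀ x, HasDerivAt p (p' x) x) (x : ℝ) :
    HasDerivAt (fun x => p x * u x ^ 2) (p' x * u x ^ 2 + p x * (2 * u x * deriv u x)) x := by
  have h := (hp x).mul ((hu x).hasDerivAt.pow 2)
  refine HasDerivAt.congr_deriv h ?_
  simp

/-- The potential on the left -/
noncomputable def V (x : ℝ) : ℝ := 1 - 12 * T x + 15 * T x ^ 2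

lemma V_cont : Continuous V := by unfold V; have := T_cont; fun_prop

lemma V_bd (x : ℝ) : |V x| ≤ 28 := by
  unfold V
  have := T_pos x; have := T_lt x
  rw [abs_le]; constructor <;> nlinarith

lemma V_lb (x : ℝ) : -2 ≤ V x := by
  unfold V
  nlinarith [sq_nonneg (5 * T x - 2)]

lemma left1 {w : ℝ → ℝ} (hw : Differentiable ℝ w) (h0 : w (Real.log 2) = 0)
    (h1 : IntegrableOn (fun x => deriv w x ^ 2) (Iic (Real.log 2)))
    (h2 : IntegrableOn (fun x => w x ^ 2) (Iic (Real.log 2))) :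
    1 / 125 * ∫ x in Iic (Real.log 2), w x ^ 2 ≤
      ∫ x in Iic (Real.log 2), (deriv w x ^ 2 + V x * w x ^ 2) := by
  have hne : ∀ x, 1 - T x ≠ 0 := fun x => by linarith [T_lt x] |> fun h : 0 < 1 - T x => h.ne'
  have hT := T_cont
  have hpd : ∀ x, HasDerivAt (fun x => 1 - 3 * T x - 1 / 125 * ((1 - T x) ^ 2)⁻¹)
      (-6 * T x * (1 - T x) - 4 / 125 * T x * ((1 - T x) ^ 2)⁻¹) x := by
    intro x
    have h := (((T_deriv x).const_mul 3).const_sub 1).sub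
      (((((T_deriv x).const_sub 1).pow 2).inv (pow_ne_zero 2 (hne x))).const_mul (1/125))
    refine HasDerivAt.congr_deriv h ?_
    have := hne x
    simp
    field_simp
    ring
  have hb : ∀ x ∈ Iic (Real.log 2), T x ≤ 4 / 5 ∧ 0 < T x ∧ ((1 - T x) ^ 2)⁻¹ ≤ 25 ∧
      0 < ((1 - T x) ^ 2)⁻¹ := by
    intro x hx
    have h : T x ≤ 4 / 5 := by rw [← T_log2]; exact T_mono hx
    refine ⟨h, T_pos x, ?_, ?_⟩
    · rw [inv_le_comm₀ (by have := hne x; positivity) (by norm_num)]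
      nlinarith
    · have := hne x; positivity
  have key := riccati (S := Iic (Real.log 2)) measurableSet_Iic (u := w)
    (p := fun x => 1 - 3 * T x - 1 / 125 * ((1 - T x) ^ 2)⁻¹)
    (p' := fun x => -6 * T x * (1 - T x) - 4 / 125 * T x * ((1 - T x) ^ 2)⁻¹)
    (V := V) (M := 28) (c := 1/125) (B := 0) hw
    (by fun_prop (disch := intro x; exact pow_ne_zero 2 (hne x)))
    (by fun_prop (disch := intro x; exact pow_ne_zero 2 (hne x))) V_cont
    (by intro x hx
        obtain ⟨a, b, c, d⟩ := hb x hx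
        rw [abs_le]; constructor <;> linarith)
    (by intro x hx
        obtain ⟨a, b, c, d⟩ := hb x hx
        have e1 : 0 < T x * ((1 - T x) ^ 2)⁻¹ := mul_pos b d
        have e2 : T x * ((1 - T x) ^ 2)⁻¹ ≤ 1 * 25 := by gcongr; linarith
        rw [abs_le]; constructor <;> nlinarith)
    (fun x _ => V_bd x) h1 h2
    (by intro x hx
        obtain ⟨a, b, c, d⟩ := hb x hx
        have hs : 1 / 5 ≤ 1 - T x := by linarith
        unfold V
        set s := 1 - T x with hs'
        have hT' : T x = 1 - s := by rw [hs']; ring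
        rw [hT']
        have hs0 : 0 < s := by linarith
        have hs1 : s < 1 := by rw [hs']; linarith
        have e : 1 - 12 * (1 - s) + 15 * (1 - s) ^ 2 -
            (-6 * (1 - s) * s - 4 / 125 * (1 - s) * (s ^ 2)⁻¹)
            - (1 - 3 * (1 - s) - 1 / 125 * (s ^ 2)⁻¹) ^ 2 - 1 / 125
            = (250 * s ^ 3 - 1 - 125 * s ^ 4) / (15625 * s ^ 4) := by
          field_simp
          ring
        have e3 : 0 ≤ (250 * s ^ 3 - 1 - 125 * s ^ 4) / (15625 * s ^ 4) := by
          apply div_nonneg _ (by positivity)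
          have h3 : (1/5)^3 ≤ s ^ 3 := by gcongr
          have h4 : s ^ 4 ≤ s ^ 3 := pow_le_pow_of_le_one hs0.le hs1.le (by norm_num)
          nlinarith
        linarith)
    (by intro i1 i2
        have := ftc_Iic (sq_deriv hw hpd) i1 i2
        rw [this, h0]; simp)
  linarith

lemma left2 {w : ℝ → ℝ} {R : ℝ} (hR : Real.log 2 ≤ R) (hw : Differentiable ℝ w)
    (h0 : w (Real.log 2) = 0)
    (h1 : IntegrableOn (fun x => deriv w x ^ 2) (Ioc (Real.log 2) R))
    (h2 : IntegrableOn (fun x => w x ^ 2) (Ioc (Real.log 2) R)) :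
    1 / 2 * w R ^ 2 + 1 / 125 * ∫ x in Ioc (Real.log 2) R, w x ^ 2 ≤
      ∫ x in Ioc (Real.log 2) R, (deriv w x ^ 2 + V x * w x ^ 2) := by
  have hT := T_cont
  have hpd : ∀ x, HasDerivAt (fun x => 7 / 2 - 3 * T x)
      (-6 * T x * (1 - T x)) x := by
    intro x
    have h := (((T_deriv x).const_mul 3).const_sub (7/2))
    refine HasDerivAt.congr_deriv h ?_
    ring
  have key := riccati (S := Ioc (Real.log 2) R) measurableSet_Ioc (u := w)
    (p := fun x => 7 / 2 - 3 * T x)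
    (p' := fun x => -6 * T x * (1 - T x))
    (V := V) (M := 28) (c := 1/125) (B := (7 / 2 - 3 * T R) * w R ^ 2) hw
    (by fun_prop) (by fun_prop) V_cont
    (by intro x hx
        have := T_pos x; have := T_lt x
        rw [abs_le]; constructor <;> linarith)
    (by intro x hx
        have := T_pos x; have := T_lt x
        rw [abs_le]; constructor <;> nlinarith)
    (fun x _ => V_bd x) h1 h2
    (by intro x hx
        have h : 4 / 5 ≤ T x := by rw [← T_log2]; exact T_mono hx.1.le
        unfold V
        nlinarith)
    (by intro i1 i2
        rw [← intervalIntegral.integral_of_le hR,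
          intervalIntegral.integral_eq_sub_of_hasDerivAt (f := fun x => (7 / 2 - 3 * T x) * w x ^ 2)
            (fun x _ => sq_deriv hw hpd x)
            ((intervalIntegrable_iff_integrableOn_Ioc_of_le hR).2 i2), h0]
        simp)
  have := T_lt R
  nlinarith [sq_nonneg (w R)]

lemma left {w : ℝ → ℝ} {R : ℝ} (hR : Real.log 2 ≤ R) (hw : Differentiable ℝ w)
    (h0 : w (Real.log 2) = 0)
    (h1 : IntegrableOn (fun x => deriv w x ^ 2) (Iic R))
    (h2 : IntegrableOn (fun x => w x ^ 2) (Iic R)) :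
    1 / 500 * ((∫ x in Iic R, deriv w x ^ 2) + (∫ x in Iic R, w x ^ 2) + w R ^ 2) ≤
      ∫ x in Iic R, (deriv w x ^ 2 + V x * w x ^ 2) := by
  have hsub : Iic (Real.log 2) ⊆ Iic R := Iic_subset_Iic.2 hR
  have hsub2 : Ioc (Real.log 2) R ⊆ Iic R := Ioc_subset_Iic_self
  have hV := bddmul measurableSet_Iic 28 V_cont (fun x _ => V_bd x) h2
  have hsum : IntegrableOn (fun x => deriv w x ^ 2 + V x * w x ^ 2) (Iic R) := h1.add hV
  have a1 := left1 hw h0 (h1.mono_set hsub) (h2.mono_set hsub)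
  have a2 := left2 hR hw h0 (h1.mono_set hsub2) (h2.mono_set hsub2)
  have hd : Disjoint (Iic (Real.log 2)) (Ioc (Real.log 2) R) := Iic_disjoint_Ioc le_rfl
  have hu := Iic_union_Ioc_eq_Iic hR
  have e1 := setIntegral_union hd measurableSet_Ioc (h2.mono_set hsub) (h2.mono_set hsub2)
  have e2 := setIntegral_union hd measurableSet_Ioc (hsum.mono_set hsub) (hsum.mono_set hsub2)
  rw [hu] at e1 e2
  have b : (∫ x in Iic R, deriv w x ^ 2) - 2 * (∫ x in Iic R, w x ^ 2) ≤
      ∫ x in Iic R, (deriv w x ^ 2 + V x * w x ^ 2) := by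
    rw [← integral_const_mul, ← integral_sub h1 (h2.const_mul 2)]
    refine setIntegral_mono_on (h1.sub (h2.const_mul 2)) hsum measurableSet_Iic fun x hx => ?_
    have := V_lb x
    nlinarith [sq_nonneg (w x)]
  have n1 : 0 ≤ ∫ x in Iic R, w x ^ 2 := integral_nonneg fun x => sq_nonneg _
  nlinarith [sq_nonneg (w R)]

lemma right {u : ℝ → ℝ} {R : ℝ} (hR : 8 / 9 ≤ T R) (hu : Differentiable ℝ u)
    (h1 : IntegrableOn (fun x => deriv u x ^ 2) (Ioi R))
    (h2 : IntegrableOn (fun x => (1 - T x) * u x ^ 2) (Ioi R)) :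
    1 / 2 * (∫ x in Ioi R, deriv u x ^ 2) + (∫ x in Ioi R, (1 - T x) * u x ^ 2)
      - 2 * (1 - T R) * u R ^ 2 ≤
      ∫ x in Ioi R, (deriv u x ^ 2 + (1 - 4 * T x + 3 * T x ^ 2) * u x ^ 2) := by
  have hT := T_cont
  have hd : ∀ x, HasDerivAt (fun x => 2 * (1 - T x) * u x ^ 2)
      (-4 * T x * (1 - T x) * u x ^ 2 + 2 * (1 - T x) * (2 * u x * deriv u x)) x := by
    apply sq_deriv hu (p := fun x => 2 * (1 - T x)) (p' := fun x => -4 * T x * (1 - T x))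
    intro x
    have h := (((T_deriv x).const_sub 1).const_mul 2)
    refine HasDerivAt.congr_deriv h ?_
    ring
  have i0 : IntegrableOn (fun x => 2 * (1 - T x) * u x ^ 2) (Ioi R) := by
    simpa [mul_assoc, IntegrableOn] using h2.const_mul 2
  have hum := hu.continuous.measurable
  have hdm := measurable_deriv u
  have hTm := T_cont.measurable
  have i1 : IntegrableOn (fun x => (1 - 3 * T x) * ((1 - T x) * u x ^ 2)) (Ioi R) :=
    bddmul measurableSet_Ioi 5 (by fun_prop) (by
      intro x hx
      have := T_pos x; have := T_lt x
      rw [abs_le]; constructor <;> linarith) h2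
  have i2 : IntegrableOn (fun x => (-4 * T x) * ((1 - T x) * u x ^ 2)) (Ioi R) :=
    bddmul measurableSet_Ioi 5 (by fun_prop) (by
      intro x hx
      have := T_pos x; have := T_lt x
      rw [abs_le]; constructor <;> linarith) h2
  have i3 : IntegrableOn (fun x => 2 * (1 - T x) * (2 * u x * deriv u x)) (Ioi R) := by
    refine Integrable.mono' ((h1.const_mul 2).add (h2.const_mul 2)) (by fun_prop)
      (Filter.Eventually.of_forall fun x => ?_)
    have := T_pos x; have := T_lt x
    have hs : 0 < 1 - T x := by linarith
    have hs1 : 1 - T x ≤ 1 := by linarith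
    have m1 : (1 - T x) * deriv u x ^ 2 ≤ deriv u x ^ 2 :=
      mul_le_of_le_one_left (sq_nonneg _) hs1
    have m2 := mul_nonneg hs.le (sq_nonneg (u x - deriv u x))
    have m3 := mul_nonneg hs.le (sq_nonneg (u x + deriv u x))
    simp only [Pi.add_apply, Real.norm_eq_abs, abs_le]
    constructor <;> nlinarith
  have i4 : IntegrableOn (fun x => -4 * T x * (1 - T x) * u x ^ 2 +
      2 * (1 - T x) * (2 * u x * deriv u x)) (Ioi R) := by
    refine (Integrable.congr i2 (Filter.Eventually.of_forall fun x => ?_)).add i3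
    simp only; ring
  have hf := ftc_Ioi hd i0 i4
  have i5 : IntegrableOn (fun x => deriv u x ^ 2 + (1 - 4 * T x + 3 * T x ^ 2) * u x ^ 2)
      (Ioi R) := by
    refine h1.add (Integrable.congr i1 (Filter.Eventually.of_forall fun x => ?_))
    simp only; ring
  have i6 : IntegrableOn (fun x => 1 / 2 * deriv u x ^ 2 + (1 - T x) * u x ^ 2) (Ioi R) :=
    (h1.const_mul (1/2)).add h2
  have e : 1 / 2 * (∫ x in Ioi R, deriv u x ^ 2) + (∫ x in Ioi R, (1 - T x) * u x ^ 2)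
      - 2 * (1 - T R) * u R ^ 2 = ∫ x in Ioi R, ((1 / 2 * deriv u x ^ 2 + (1 - T x) * u x ^ 2) +
      (-4 * T x * (1 - T x) * u x ^ 2 + 2 * (1 - T x) * (2 * u x * deriv u x))) := by
    rw [integral_add i6 i4, hf, integral_add (h1.const_mul (1/2)) h2, integral_const_mul]
    ring
  rw [e]
  refine setIntegral_mono_on (i6.add i4) i5 measurableSet_Ioi fun x hx => ?_
  have ht : 8 / 9 ≤ T x := hR.trans (T_mono (le_of_lt hx))
  have hs : 0 < 1 - T x := by linarith [T_lt x]
  have m1 : 0 ≤ (1 - T x) * (9 * T x - 8) * u x ^ 2 :=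
    mul_nonneg (mul_nonneg hs.le (by linarith)) (sq_nonneg _)
  nlinarith [sq_nonneg (deriv u x - 4 * (1 - T x) * u x)]

lemma T_tendsto_bot : Filter.Tendsto T Filter.atBot (nhds 0) := by
  have h4 : T = fun x => (1 + Real.exp (-(2 * x)))⁻¹ := rfl
  rw [h4]
  have h : Filter.Tendsto (fun x : ℝ => -(2 * x)) Filter.atBot Filter.atTop :=
    Filter.tendsto_neg_atBot_atTop.comp
      (Filter.tendsto_id.const_mul_atBot (by norm_num : (0:ℝ) < 2))
  exact (Filter.tendsto_atTop_add_const_left _ 1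
    (Real.tendsto_exp_atTop.comp h)).inv_tendsto_atTop

lemma psi_deriv2 (x : ℝ) : HasDerivAt (fun x => (1 - 3 * T x) * psi x) (V x * psi x) x := by
  have h := (((T_deriv x).const_mul 3).const_sub 1).mul (psi_deriv x)
  refine HasDerivAt.congr_deriv h ?_
  unfold V
  ring

lemma tail (R : ℝ) : IntegrableOn (fun x => T x * (1 - T x)) (Ioi R) ∧
    ∫ x in Ioi R, T x * (1 - T x) = (1 - T R) / 2 := by
  have hd : ∀ x, HasDerivAt (fun x => 1 / 2 * T x) (T x * (1 - T x)) x := fun x =>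
    HasDerivAt.congr_deriv ((T_deriv x).const_mul (1/2)) (by ring)
  have hp : ∀ x, 0 ≤ T x * (1 - T x) := fun x =>
    mul_nonneg (T_pos x).le (by linarith [T_lt x])
  have ht := T_tendsto.const_mul (1/2)
  have hi := integrableOn_Ioi_deriv_of_nonneg' (a := R) (fun x _ => hd x) (fun x _ => hp x) ht
  refine ⟨hi, ?_⟩
  rw [integral_Ioi_of_hasDerivAt_of_tendsto' (fun x _ => hd x) hi ht]
  ring

lemma psi_int (R : ℝ) : IntegrableOn (fun x => psi x ^ 2) (Iic R) ∧
    ∫ x in Iic R, psi x ^ 2 = T R / 2 - T R ^ 2 / 4 := by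
  have hd : ∀ x, HasDerivAt (fun x => 1 / 2 * T x - 1 / 4 * T x ^ 2) (psi x ^ 2) x := fun x =>
    HasDerivAt.congr_deriv (((T_deriv x).const_mul (1/2)).sub
      (((T_deriv x).pow 2).const_mul (1/4))) (by rw [psi_sq]; simp; ring)
  have ht : Filter.Tendsto (fun x => 1 / 2 * T x - 1 / 4 * T x ^ 2) Filter.atBot (nhds 0) := by
    have := (T_tendsto_bot.const_mul (1/2)).sub ((T_tendsto_bot.pow 2).const_mul (1/4))
    simpa using this
  have hi : IntegrableOn (fun x => psi x ^ 2) (Iic R) := by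
    refine integrableOn_Iic_of_intervalIntegral_norm_bounded (l := Filter.atBot) (a := id) 1 R
      (fun i => ?_) Filter.tendsto_id ?_
    · exact ((psi_cont.pow 2).integrableOn_Icc).mono_set Ioc_subset_Icc_self
    · filter_upwards with i
      have e : (fun x => ‖psi x ^ 2‖) = fun x => psi x ^ 2 := by
        funext x; exact Real.norm_of_nonneg (sq_nonneg _)
      simp only [e]
      rw [intervalIntegral.integral_eq_sub_of_hasDerivAt (fun x _ => hd x)
        ((psi_cont.pow 2).intervalIntegrable _ _)]
      have := T_pos R; have := T_lt R; have := T_pos i; have := T_lt i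
      simp only [id]
      nlinarith
  refine ⟨hi, ?_⟩
  rw [integral_Iic_of_hasDerivAt_of_tendsto' (fun x _ => hd x) hi ht]
  ring

lemma sub_sq_int {f g : ℝ → ℝ} {S : Set ℝ} (a : ℝ) (hf : Measurable f) (hg : Measurable g)
    (h1 : IntegrableOn (fun x => f x ^ 2) S) (h2 : IntegrableOn (fun x => g x ^ 2) S) :
    IntegrableOn (fun x => (f x - a * g x) ^ 2) S := by
  have h3 := prodint hf hg h1 h2
  have := (h1.sub (h3.const_mul (2 * a))).add (h2.const_mul (a ^ 2))
  refine Integrable.congr this (Filter.Eventually.of_forall fun x => ?_)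
  simp only [Pi.add_apply, Pi.sub_apply]
  ring

lemma add_sq_bd {f g : ℝ → ℝ} {S : Set ℝ} (hS : MeasurableSet S) (a : ℝ)
    (h1 : IntegrableOn (fun x => (f x - a * g x) ^ 2) S)
    (h2 : IntegrableOn (fun x => g x ^ 2) S) (h3 : IntegrableOn (fun x => f x ^ 2) S) :
    ∫ x in S, f x ^ 2 ≤ 2 * (∫ x in S, (f x - a * g x) ^ 2) + 2 * a ^ 2 * ∫ x in S, g x ^ 2 := by
  rw [← integral_const_mul, ← integral_const_mul,
    ← integral_add (h1.const_mul 2) (h2.const_mul (2 * a ^ 2))]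
  refine setIntegral_mono_on h3 ((h1.const_mul 2).add (h2.const_mul (2 * a ^ 2))) hS fun x hx => ?_
  nlinarith [sq_nonneg (f x - 2 * a * g x)]

lemma arith {q qr A D B N U U' P' P v y k s a : ℝ}
    (hright : 1 / 2 * B + N - 2 * s * (v + a * y) ^ 2 ≤ qr)
    (hleft : 1 / 500 * (D + A + v ^ 2) ≤ q)
    (bU : U ≤ 2 * A + 2 * a ^ 2 * P) (bU' : U' ≤ 2 * D + 2 * a ^ 2 * P')
    (p1e : P' ≤ 4 * P) (hcon : a ^ 2 ≤ 8 * (A + N)) (hP4 : P ≤ 1 / 4)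
    (A0 : 0 ≤ A) (D0 : 0 ≤ D) (B0 : 0 ≤ B) (N0 : 0 ≤ N) (hs0 : 0 < s) (hs : s ≤ 1 / 100000)
    (hps : y ≤ s) (hpp : 0 < y) (hk : -2 ≤ k) (hk2 : k ≤ 0) :
    U' + B + U + N / s ≤ 1000 * (22 + 1 / s) *
      (q + (2 * a * (k * y) * v + a ^ 2 * (k * y) * y) + qr) := by
  have ea : 0 ≤ a ^ 2 := sq_nonneg a
  have ev : 0 ≤ v ^ 2 := sq_nonneg v
  have e1 : -(2 * s * (a ^ 2 + v ^ 2)) ≤ 2 * a * (k * y) * v := by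
    have g1 : 0 ≤ -k * y := mul_nonneg (by linarith) hpp.le
    have g2 : -k * y ≤ 2 * s := mul_le_mul (by linarith) hps hpp.le (by norm_num)
    have g3 : 0 ≤ (2 * s + k * y) * (a ^ 2 + v ^ 2) := mul_nonneg (by linarith) (by linarith)
    nlinarith [mul_nonneg g1 (sq_nonneg (a - v))]
  have hys : y ^ 2 ≤ s := by nlinarith
  have e2 : -(2 * s * a ^ 2) ≤ a ^ 2 * (k * y) * y := by
    have g : 0 ≤ k * y ^ 2 + 2 * s := by nlinarith
    nlinarith [mul_nonneg ea g]
  have e3 : 2 * s * (v + a * y) ^ 2 ≤ 4 * s * (a ^ 2 + v ^ 2) := by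
    have g1 : (v + a * y) ^ 2 ≤ 2 * (a ^ 2 + v ^ 2) := by
      have : a ^ 2 * y ^ 2 ≤ a ^ 2 * 1 := mul_le_mul_of_nonneg_left (by linarith) ea
      nlinarith [sq_nonneg (v - a * y)]
    nlinarith
  have e4 : s * a ^ 2 ≤ 1 / 100000 * a ^ 2 := mul_le_mul_of_nonneg_right hs ea
  have e5 : s * v ^ 2 ≤ 1 / 100000 * v ^ 2 := mul_le_mul_of_nonneg_right hs ev
  have main : A + D + N + B ≤ 1000 * (q + (2 * a * (k * y) * v + a ^ 2 * (k * y) * y) + qr) := by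
    nlinarith
  have f1 : U ≤ 6 * A + 4 * N := by
    have := mul_le_mul_of_nonneg_left hP4 ea
    nlinarith
  have f2 : U' ≤ 2 * D + 16 * (A + N) := by
    have : P' ≤ 1 := by linarith
    have := mul_le_mul_of_nonneg_left this ea
    nlinarith
  have i0 : 0 < 1 / s := by positivity
  calc U' + B + U + N / s ≤ (22 + 1 / s) * (A + D + N + B) := by
        have : N / s = 1 / s * N := by ring
        rw [this]
        have := mul_nonneg i0.le A0
        have := mul_nonneg i0.le D0
        have := mul_nonneg i0.le B0
        nlinarith
    _ ≤ (22 + 1 / s) * (1000 * (q + (2 * a * (k * y) * v + a ^ 2 * (k * y) * y) + qr)) :=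
        mul_le_mul_of_nonneg_left main (by positivity)
    _ = _ := by ring

set_option maxHeartbeats 1000000 in
theorem core {R : ℝ} (hlog : Real.log 2 ≤ R) (hs : 1 - T R ≤ 1 / 100000) {u : ℝ → ℝ}
    (hu : Differentiable ℝ u) (h1 : Integrable (fun x => deriv u x ^ 2))
    (h2 : IntegrableOn (fun x => u x ^ 2) (Iic R))
    (h3 : IntegrableOn (fun x => (1 - T x) * u x ^ 2) (Ioi R))
    (h4 : ∫ x, u x * psi x = 0) :
    (∫ x in Iic R, deriv u x ^ 2) + (∫ x in Ioi R, deriv u x ^ 2) + (∫ x in Iic R, u x ^ 2)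
      + (∫ x in Ioi R, (1 - T x) * u x ^ 2) / (1 - T R) ≤ 1000 * (22 + 1 / (1 - T R)) *
    ((∫ x in Iic R, (deriv u x ^ 2 + V x * u x ^ 2)) +
      ∫ x in Ioi R, (deriv u x ^ 2 + (1 - 4 * T x + 3 * T x ^ 2) * u x ^ 2)) := by
  have hR8 : 8 / 9 ≤ T R := by linarith
  have hright := right hR8 hu h1.integrableOn h3
  have hum := hu.continuous.measurable
  have hdm := measurable_deriv u
  have hTm := T_cont.measurable
  have hpm := psi_cont.measurable
  have hT := T_cont
  obtain ⟨ti, te⟩ := tail R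
  obtain ⟨pi1, pe⟩ := psi_int R
  obtain ⟨a, ha⟩ : ∃ a, a = u (Real.log 2) / psi (Real.log 2) := ⟨_, rfl⟩
  obtain ⟨w, hwdef⟩ : ∃ w : ℝ → ℝ, w = fun x => u x - a * psi x := ⟨_, rfl⟩
  have hwx : ∀ x, w x = u x - a * psi x := fun x => by rw [hwdef]
  have hwd : ∀ x, HasDerivAt w (deriv u x - a * ((1 - 3 * T x) * psi x)) x := by
    intro x
    rw [hwdef]
    exact (hu x).hasDerivAt.sub ((psi_deriv x).const_mul a)
  have hwdx : ∀ x, deriv w x = deriv u x - a * ((1 - 3 * T x) * psi x) := fun x => (hwd x).deriv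
  have hwD : Differentiable ℝ w := fun x => (hwd x).differentiableAt
  have hw0 : w (Real.log 2) = 0 := by
    rw [hwx, ha, div_mul_cancel₀ _ (psi_pos _).ne', sub_self]
  have p1i : IntegrableOn (fun x => ((1 - 3 * T x) * psi x) ^ 2) (Iic R) := by
    have := bddmul (q := fun x => (1 - 3 * T x) ^ 2) measurableSet_Iic 4 (by fun_prop) (by
      intro x _
      have := T_pos x; have := T_lt x
      rw [abs_le]; constructor <;> nlinarith) pi1
    refine Integrable.congr this (Filter.Eventually.of_forall fun x => ?_)
    simp only; ring
  have p1e : ∫ x in Iic R, ((1 - 3 * T x) * psi x) ^ 2 ≤ 4 * ∫ x in Iic R, psi x ^ 2 := by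
    rw [← integral_const_mul]
    refine setIntegral_mono_on p1i (pi1.const_mul 4) measurableSet_Iic fun x _ => ?_
    have := T_pos x; have := T_lt x
    rw [mul_pow]
    refine mul_le_mul_of_nonneg_right ?_ (sq_nonneg _)
    nlinarith
  have hu1L : IntegrableOn (fun x => deriv u x ^ 2) (Iic R) := h1.integrableOn
  have hw2 : IntegrableOn (fun x => (u x - a * psi x) ^ 2) (Iic R) :=
    sub_sq_int a hum hpm h2 pi1
  have hw1 : IntegrableOn (fun x => (deriv u x - a * ((1 - 3 * T x) * psi x)) ^ 2) (Iic R) :=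
    sub_sq_int a hdm (by fun_prop) hu1L p1i
  have hleft := left hlog hwD hw0 (by simpa only [hwdx] using hw1) (by simpa only [hwx] using hw2)
  have bU := add_sq_bd measurableSet_Iic a hw2 pi1 h2
  have bU' := add_sq_bd measurableSet_Iic a hw1 p1i hu1L
  -- the energy identity on the left
  have hw2' : IntegrableOn (fun x => w x ^ 2) (Iic R) := by simpa only [hwx] using hw2
  have hw1' : IntegrableOn (fun x => deriv w x ^ 2) (Iic R) := by simpa only [hwdx] using hw1
  have hE : ∫ x in Iic R, (deriv u x ^ 2 + V x * u x ^ 2) =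
      (∫ x in Iic R, (deriv w x ^ 2 + V x * w x ^ 2)) +
      (2 * a * ((1 - 3 * T R) * psi R) * w R + a ^ 2 * ((1 - 3 * T R) * psi R) * psi R) := by
    have iw : IntegrableOn (fun x => deriv w x ^ 2 + V x * w x ^ 2) (Iic R) :=
      hw1'.add (bddmul measurableSet_Iic 28 V_cont (fun x _ => V_bd x) hw2')
    have iu : IntegrableOn (fun x => deriv u x ^ 2 + V x * u x ^ 2) (Iic R) :=
      hu1L.add (bddmul measurableSet_Iic 28 V_cont (fun x _ => V_bd x) h2)
    have hd : ∀ x, HasDerivAt (fun x => 2 * a * ((1 - 3 * T x) * psi x) * w x +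
        a ^ 2 * ((1 - 3 * T x) * psi x) * psi x)
        ((deriv u x ^ 2 + V x * u x ^ 2) - (deriv w x ^ 2 + V x * w x ^ 2)) x := by
      intro x
      have h := (((psi_deriv2 x).const_mul (2 * a)).mul (hwd x)).add
        (((psi_deriv2 x).const_mul (a ^ 2)).mul (psi_deriv x))
      refine HasDerivAt.congr_deriv h ?_
      rw [hwx, hwdx]
      ring
    have iF : IntegrableOn (fun x => 2 * a * ((1 - 3 * T x) * psi x) * w x +
        a ^ 2 * ((1 - 3 * T x) * psi x) * psi x) (Iic R) := by
      have hm : Measurable fun x => (1 - 3 * T x) * psi x := by fun_prop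
      have j1 := (prodint hm hwD.continuous.measurable p1i hw2').const_mul (2 * a)
      have j2 := (prodint hm hpm p1i pi1).const_mul (a ^ 2)
      refine Integrable.congr (j1.add j2) (Filter.Eventually.of_forall fun x => ?_)
      simp only [Pi.add_apply]; ring
    have := ftc_Iic hd iF (iu.sub iw)
    rw [← this, integral_sub iu iw]
    ring
  -- the orthogonality constraint
  have hcon : a ^ 2 ≤ 8 * ((∫ x in Iic R, w x ^ 2) + ∫ x in Ioi R, (1 - T x) * u x ^ 2) := by
    have k1 : IntegrableOn (fun x => u x * psi x) (Iic R) := prodint hum hpm h2 pi1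
    have k2 : IntegrableOn (fun x => u x * psi x) (Ioi R) := by
      refine Integrable.mono' (h3.add ti) (by fun_prop) (Filter.Eventually.of_forall fun x => ?_)
      have hs0 : 0 < 1 - T x := by linarith [T_lt x]
      have m1 := mul_nonneg hs0.le (sq_nonneg (u x + φ x))
      have m2 := mul_nonneg hs0.le (sq_nonneg (u x - φ x))
      have m3 := mul_nonneg hs0.le (sq_nonneg (u x))
      have m4 := mul_nonneg hs0.le (sq_nonneg (φ x))
      have e1 : (1 - T x) * (u x + φ x) ^ 2 =
        (1 - T x) * u x ^ 2 + 2 * (u x * psi x) + (φ x) ^ 2 * (1 - T x) := by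
        unfold psi; ring
      have e2 : (1 - T x) * (u x - φ x) ^ 2 =
        (1 - T x) * u x ^ 2 - 2 * (u x * psi x) + (φ x) ^ 2 * (1 - T x) := by
        unfold psi; ring
      rw [phi_sq] at e1 e2 m4
      simp only [Pi.add_apply, Real.norm_eq_abs, abs_le]
      constructor <;> linarith
    have hsplit := intervalIntegral.integral_Iic_add_Ioi k1 k2
    rw [h4] at hsplit
    have l1 : (3 / 4) * a ^ 2 * (∫ x in Iic R, psi x ^ 2) - (∫ x in Iic R, w x ^ 2) ≤
        a * ∫ x in Iic R, u x * psi x := by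
      rw [← integral_const_mul, ← integral_const_mul,
        ← integral_sub (pi1.const_mul _) hw2']
      refine setIntegral_mono_on ((pi1.const_mul _).sub hw2') (k1.const_mul a)
        measurableSet_Iic fun x _ => ?_
      rw [hwx]
      nlinarith [sq_nonneg (u x - a * psi x + a / 2 * psi x)]
    have l2 : - (a ^ 2 / 4) * (∫ x in Ioi R, T x * (1 - T x)) -
        (∫ x in Ioi R, (1 - T x) * u x ^ 2) ≤ a * ∫ x in Ioi R, u x * psi x := by
      rw [← integral_const_mul, ← integral_const_mul,
        ← integral_sub (ti.const_mul _) h3]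
      refine setIntegral_mono_on ((ti.const_mul _).sub h3) (k2.const_mul a)
        measurableSet_Ioi fun x _ => ?_
      have hs0 : 0 < 1 - T x := by linarith [T_lt x]
      have m1 := mul_nonneg hs0.le (sq_nonneg (u x + a / 2 * φ x))
      have e : (1 - T x) * (u x + a / 2 * φ x) ^ 2 =
        (1 - T x) * u x ^ 2 + a * (u x * psi x) + a ^ 2 / 4 * ((φ x) ^ 2 * (1 - T x)) := by
        unfold psi; ring
      rw [phi_sq] at e
      linarith
    have l3 : a * (∫ x in Iic R, u x * psi x) + a * (∫ x in Ioi R, u x * psi x) = 0 := by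
      rw [← mul_add, hsplit, mul_zero]
    rw [pe] at l1
    rw [te] at l2
    have hP : 24 / 100 ≤ T R / 2 - T R ^ 2 / 4 := by
      have := T_lt R
      nlinarith
    have m1 := mul_le_mul_of_nonneg_left hP (sq_nonneg a)
    have m2 := mul_le_mul_of_nonneg_left hs (sq_nonneg a)
    clear * - l1 l2 l3 m1 m2
    nlinarith only [l1, l2, l3, m1, m2, sq_nonneg a]
  have hP4 : ∫ x in Iic R, psi x ^ 2 ≤ 1 / 4 := by
    rw [pe]; nlinarith [sq_nonneg (T R - 1)]
  rw [hE]
  simp only [← hwx, ← hwdx] at bU bU'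
  have huR : u R = w R + a * psi R := by rw [hwx]; ring
  rw [huR] at hright
  have A0 : 0 ≤ ∫ x in Iic R, w x ^ 2 := integral_nonneg fun x => sq_nonneg _
  have D0 : 0 ≤ ∫ x in Iic R, deriv w x ^ 2 := integral_nonneg fun x => sq_nonneg _
  have B0 : 0 ≤ ∫ x in Ioi R, deriv u x ^ 2 := integral_nonneg fun x => sq_nonneg _
  have N0 : 0 ≤ ∫ x in Ioi R, (1 - T x) * u x ^ 2 := integral_nonneg fun x =>
    mul_nonneg (by linarith [T_lt x]) (sq_nonneg _)
  have hs0 : 0 < 1 - T R := by linarith [T_lt R]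
  have hps : psi R ≤ 1 - T R := by
    unfold psi
    have : φ R ≤ 1 := by nlinarith [phi_sq R, phi_pos R, T_lt R]
    nlinarith
  have hpp := psi_pos R
  have hk : -2 ≤ 1 - 3 * T R := by linarith [T_lt R]
  have hk2 : 1 - 3 * T R ≤ 0 := by linarith
  exact arith hright hleft bU bU' p1e hcon hP4 A0 D0 B0 N0 hs0 hs hps hpp hk hk2

theorem coercivity_QR :
    ∃ R₀ > (0 : ℝ), ∀ R > R₀, ∃ C > (0 : ℝ),
      ∀ u : ℝ → ℝ, Differentiable ℝ u →
        Integrable (fun x => (deriv u x) ^ 2) →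
        Integrable (fun x => W R x * (u x) ^ 2) →
        (∫ x : ℝ, u x * deriv φ x) = 0 →
        C * ((∫ x : ℝ, (deriv u x) ^ 2) + ∫ x : ℝ, W R x * (u x) ^ 2) ≤
          (∫ x in Iic R,
            ((deriv u x) ^ 2 + (1 - 12 * (φ x) ^ 2 + 15 * (φ x) ^ 4) * (u x) ^ 2)) +
          (∫ x in Ioi R,
            ((deriv u x) ^ 2 + (1 - 4 * (φ x) ^ 2 + 3 * (φ x) ^ 4) * (u x) ^ 2)) := by
  obtain ⟨N₀, hN⟩ := Filter.eventually_atTop.1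
    (T_tendsto.eventually (lt_mem_nhds (show (1 - 1 / 100000 : ℝ) < 1 by norm_num)))
  refine ⟨max N₀ 1, lt_max_of_lt_right one_pos, fun R hR => ?_⟩
  have hs : 1 - T R ≤ 1 / 100000 := by
    have := hN R ((le_max_left _ _).trans hR.le)
    linarith
  have hlog : Real.log 2 ≤ R := by
    have h1 : 1 < R := (le_max_right _ _).trans_lt hR
    have := Real.log_two_lt_d9
    linarith
  have hs0 : 0 < 1 - T R := by linarith [T_lt R]
  refine ⟨(1000 * (22 + 1 / (1 - T R)))⁻¹, by positivity, fun u hu h1 hW h4 => ?_⟩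
  have wl : ∀ x ∈ Iic R, W R x * u x ^ 2 = u x ^ 2 := by
    intro x hx
    simp [W, mem_Iic.1 hx]
  have wr : ∀ x ∈ Ioi R, W R x * u x ^ 2 = ((1 - T x) * u x ^ 2) / (1 - T R) := by
    intro x hx
    have : ¬ x ≤ R := not_le.2 hx
    simp only [W, this, if_false, phi_sq]
    ring
  have h2 : IntegrableOn (fun x => u x ^ 2) (Iic R) :=
    (hW.integrableOn).congr_fun wl measurableSet_Iic
  have h3 : IntegrableOn (fun x => (1 - T x) * u x ^ 2) (Ioi R) := by
    have : IntegrableOn (fun x => ((1 - T x) * u x ^ 2) / (1 - T R)) (Ioi R) :=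
      (hW.integrableOn).congr_fun wr measurableSet_Ioi
    refine Integrable.congr (this.mul_const (1 - T R)) (Filter.Eventually.of_forall fun x => ?_)
    exact div_mul_cancel₀ _ hs0.ne'
  have h4' : ∫ x, u x * psi x = 0 := by
    rw [← h4]
    congr 1
    funext x
    rw [(phi_deriv x).deriv]
    rfl
  have := core hlog hs hu h1 h2 h3 h4'
  rw [inv_mul_le_iff₀ (by positivity)]
  rw [← intervalIntegral.integral_Iic_add_Ioi (b := R) h1.integrableOn h1.integrableOn,
    ← intervalIntegral.integral_Iic_add_Ioi (b := R) hW.integrableOn hW.integrableOn,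
    setIntegral_congr_fun measurableSet_Iic wl, setIntegral_congr_fun measurableSet_Ioi wr,
    integral_div]
  simp only [phi_4, phi_sq]
  unfold V at this
  linarith
end
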